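/- Let m ≥ 2 and n ≥ 1, let A be an mth-order n-dimensional strictly semi-positive real tensor with β(A) = min{ max_{1 ≤ i ≤ n} x_i (A x^{m-1})_i : x ≥ 0, ‖x‖_∞ = 1 }, and let q ∈ ℝⁿ, a ∈ ℝⁿ with a ≥ 0, b ∈ ℝⁿ with b > 0, and t ∈ (0,1). Suppose x, y ∈ ℝⁿ satisfy x ≥ 0, y ≥ 0, x_i y_i = t a_i for all i, and y = (1−t)(A x^{m-1} + q) + t b. Then ‖x‖_∞^{m−1} ≤ max{ 1, (max_i a_i + ‖q‖_∞ + ‖b‖_∞) / ((1−t) β(A)) }. -/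

import Mathlib

open Finset Filter

/-- `A x^{m-1}`: the vector whose `i`-th entry is the sum over all tuples of the
remaining `r = m-1` indices of the tensor entry times the product of components of `x`. -/
noncomputable def tApply {n r : ℕ} (A : Fin n → (Fin r → Fin n) → ℝ) (x : Fin n → ℝ) :
    Fin n → ℝ :=
  fun i => ∑ j : Fin r → Fin n, A i j * ∏ k, x (j k)

/-- A tensor is strictly semi-positive if for every nonzero nonnegative `x` there is an
index `i` with `x i > 0` and `(A x^{m-1}) i > 0`. -/
def StrictlySemiPositive {n r : ℕ} (A : Fin n → (Fin r → Fin n) → ℝ) : Prop :=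
  ∀ x : Fin n → ℝ, (∀ i, 0 ≤ x i) → x ≠ 0 → ∃ i, 0 < x i ∧ 0 < tApply A x i

/-- `f` is a P-function on the nonnegative orthant: for distinct nonnegative `x, y`,
`max_i (x_i - y_i)(f_i(x) - f_i(y)) > 0`. -/
def PFunctionOn {n : ℕ} (f : (Fin n → ℝ) → Fin n → ℝ) : Prop :=
  ∀ x y : Fin n → ℝ, (∀ i, 0 ≤ x i) → (∀ i, 0 ≤ y i) → x ≠ y →
    ∃ i, 0 < (x i - y i) * (f x i - f y i)

/-- A tensor is strong strictly semi-positive if `x ↦ A x^{m-1} + q` is a P-function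
on the nonnegative orthant for every `q`. -/
def StrongStrictlySemiPositive {n r : ℕ} (A : Fin n → (Fin r → Fin n) → ℝ) : Prop :=
  ∀ q : Fin n → ℝ, PFunctionOn (fun x i => tApply A x i + q i)

/-- The solution set of the tensor complementarity problem TCP(A, q). -/
noncomputable def TCPSol {n r : ℕ} (A : Fin n → (Fin r → Fin n) → ℝ) (q : Fin n → ℝ) :
    Set (Fin n → ℝ) :=
  {x | (∀ i, 0 ≤ x i) ∧ (∀ i, 0 ≤ tApply A x i + q i) ∧
    ∑ i, x i * (tApply A x i + q i) = 0}

/-- `max_{1 ≤ i ≤ n} x_i (A x^{m-1})_i`. -/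
noncomputable def maxTerm {n r : ℕ} (hn : 0 < n) (A : Fin n → (Fin r → Fin n) → ℝ)
    (x : Fin n → ℝ) : ℝ :=
  Finset.univ.sup' (Finset.univ_nonempty_iff.mpr ⟨⟨0, hn⟩⟩) (fun i => x i * tApply A x i)

theorem tApply_smul {n r : ℕ} (A : Fin n → (Fin r → Fin n) → ℝ) (c : ℝ) (x : Fin n → ℝ) :
    tApply A (c • x) = c ^ r • tApply A x := by
  ext i
  simp only [tApply, Pi.smul_apply, smul_eq_mul, Finset.prod_mul_distrib, Finset.prod_const,
    Finset.card_univ, Fintype.card_fin, Finset.mul_sum]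
  exact Finset.sum_congr rfl fun j _ => by ring

theorem exists_maxTerm_eq {n r : ℕ} (hn : 0 < n) (A : Fin n → (Fin r → Fin n) → ℝ)
    (x : Fin n → ℝ) : ∃ i, maxTerm hn A x = x i * tApply A x i := by
  obtain ⟨i, -, hi⟩ := Finset.exists_mem_eq_sup' (Finset.univ_nonempty_iff.mpr ⟨⟨0, hn⟩⟩)
    (fun i => x i * tApply A x i)
  exact ⟨i, hi⟩

theorem le_maxTerm {n r : ℕ} (hn : 0 < n) (A : Fin n → (Fin r → Fin n) → ℝ)
    (x : Fin n → ℝ) (i : Fin n) : x i * tApply A x i ≤ maxTerm hn A x :=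
  Finset.le_sup' (fun i => x i * tApply A x i) (Finset.mem_univ i)

theorem StrictlySemiPositive.maxTerm_pos {n r : ℕ} {A : Fin n → (Fin r → Fin n) → ℝ}
    (hA : StrictlySemiPositive A) (hn : 0 < n) {x : Fin n → ℝ} (hx : ∀ i, 0 ≤ x i)
    (hx0 : x ≠ 0) : 0 < maxTerm hn A x := by
  obtain ⟨i, hi, hAi⟩ := hA x hx hx0
  exact (mul_pos hi hAi).trans_le (le_maxTerm hn A x i)

/-- A lower bound for `maxTerm` on the nonnegative unit sphere extends to the nonnegative
orthant by homogeneity. -/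
theorem exists_mul_pow_norm_le {n r : ℕ} (hn : 0 < n) {A : Fin n → (Fin r → Fin n) → ℝ} {β : ℝ}
    (hβ : β ∈ lowerBounds {s : ℝ | ∃ x : Fin n → ℝ,
      (∀ i, 0 ≤ x i) ∧ ‖x‖ = 1 ∧ maxTerm hn A x = s})
    {x : Fin n → ℝ} (hx : ∀ i, 0 ≤ x i) (hx0 : x ≠ 0) :
    ∃ i, β * ‖x‖ ^ (r + 1) ≤ x i * tApply A x i := by
  have hN : 0 < ‖x‖ := norm_pos_iff.mpr hx0
  obtain ⟨i, hi⟩ := exists_maxTerm_eq hn A (‖x‖⁻¹ • x)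
  have hβi : β ≤ maxTerm hn A (‖x‖⁻¹ • x) :=
    hβ ⟨_, fun i => mul_nonneg (inv_nonneg.mpr hN.le) (hx i),
      norm_smul_inv_norm (𝕜 := ℝ) hx0, rfl⟩
  refine ⟨i, ?_⟩
  rw [hi, tApply_smul] at hβi
  simp only [Pi.smul_apply, smul_eq_mul] at hβi
  rw [← le_div_iff₀ (by positivity)]
  refine hβi.trans_eq ?_
  rw [inv_pow]
  field_simp
  ring

theorem trajectory_x_bound
    (m n : ℕ) (hm : 2 ≤ m) (hn : 0 < n)
    (A : Fin n → (Fin (m - 1) → Fin n) → ℝ)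
    (hA : StrictlySemiPositive A) (β : ℝ)
    (hβ : IsLeast {r : ℝ | ∃ x : Fin n → ℝ,
        (∀ i, 0 ≤ x i) ∧ ‖x‖ = 1 ∧ maxTerm hn A x = r} β)
    (q a b : Fin n → ℝ) (ha : ∀ i, 0 ≤ a i) (hb : ∀ i, 0 < b i)
    (t : ℝ) (ht : t ∈ Set.Ioo (0 : ℝ) 1)
    (x y : Fin n → ℝ) (hx : ∀ i, 0 ≤ x i) (hy : ∀ i, 0 ≤ y i)
    (hxy : ∀ i, x i * y i = t * a i)
    (hyeq : ∀ i, y i = (1 - t) * (tApply A x i + q i) + t * b i) :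
    ‖x‖ ^ (m - 1) ≤
      max 1 ((Finset.univ.sup' (Finset.univ_nonempty_iff.mpr ⟨⟨0, hn⟩⟩) a + ‖q‖ + ‖b‖) /
        ((1 - t) * β)) := by
  obtain ⟨ht0, ht1⟩ := ht
  obtain ⟨u, hu, hu1, huβ⟩ := hβ.1
  have hβ0 : 0 < β := huβ ▸ hA.maxTerm_pos hn hu (by rintro rfl; simp at hu1)
  rcases le_or_gt ‖x‖ 1 with hx1 | hx1
  · exact le_max_of_le_left (pow_le_one₀ (norm_nonneg x) hx1)
  refine le_max_of_le_right ?_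
  have hN : 0 < ‖x‖ := zero_lt_one.trans hx1
  obtain ⟨i, hi⟩ := exists_mul_pow_norm_le hn hβ.2 hx (norm_pos_iff.mp hN)
  rw [le_div_iff₀ (mul_pos (sub_pos.mpr ht1) hβ0)]
  set M := Finset.univ.sup' (Finset.univ_nonempty_iff.mpr ⟨⟨0, hn⟩⟩) a
  have haM : a i ≤ M := Finset.le_sup' a (Finset.mem_univ i)
  have hta : t * a i ≤ ‖x‖ * M :=
    mul_le_mul (ht1.le.trans hx1.le) haM (ha i) hN.le
  have hq : -(x i * q i) ≤ ‖x‖ * ‖q‖ :=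
    (neg_le_abs _).trans <| by
      rw [abs_mul]
      exact mul_le_mul (norm_le_pi_norm x i) (norm_le_pi_norm q i) (abs_nonneg _) hN.le
  have htq : (1 - t) * -(x i * q i) ≤ ‖x‖ * ‖q‖ :=
    (mul_le_mul_of_nonneg_left hq (sub_pos.mpr ht1).le).trans
      (mul_le_of_le_one_left (by positivity) (by linarith))
  have htb : 0 ≤ t * (x i * b i) := mul_nonneg ht0.le (mul_nonneg (hx i) (hb i).le)
  have hNb : 0 ≤ ‖x‖ * ‖b‖ := by positivity
  have hxA : (1 - t) * (x i * tApply A x i) =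
      t * a i + (1 - t) * -(x i * q i) - t * (x i * b i) := by
    rw [← hxy i, hyeq i]
    ring
  refine le_of_mul_le_mul_left ?_ hN
  calc ‖x‖ * (‖x‖ ^ (m - 1) * ((1 - t) * β))
      = (1 - t) * (β * ‖x‖ ^ (m - 1 + 1)) := by ring
    _ ≤ (1 - t) * (x i * tApply A x i) := mul_le_mul_of_nonneg_left hi (sub_pos.mpr ht1).le
    _ ≤ ‖x‖ * (M + ‖q‖ + ‖b‖) := by rw [hxA]; linarith
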